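/- Let Q be a finite acyclic quiver, R and T commutative rings with a ring homomorphism R → T, and suppose 0 → P⁻¹ → P⁰ → X → 0 is an exact sequence of RQ-modules with P⁻¹, P⁰ finitely generated projective (so X is an RQ-lattice of projective dimension ≤ 1). Then for any RQ-module Y there is a natural surjection T ⊗_R Ext¹_{RQ}(X, Y) → Ext¹_{TQ}(T ⊗_R X, T ⊗_R Y); moreover if Tor₁^R(T, Ext¹_{RQ}(X,Y)) behaves trivially (e.g. T is flat over R, or X, Y are lattices and the Hom and Ext modules are R-projective), this map is an isomorphism. -/

import Mathlib

open Finset TensorProduct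

variable {V A : Type} [Fintype V] [DecidableEq V] [Fintype A]

/-- A finite quiver is acyclic iff its vertices can be graded so that
every arrow strictly increases the grading. -/
def IsAcyclic (s t : A → V) : Prop :=
  ∃ ord : V → ℕ, ∀ a : A, ord (s a) < ord (t a)

/-- A representation of the quiver `Q = (V, A, s, t)` over a commutative ring `R`;
equivalently, an `RQ`-module. -/
structure QRepR (R : Type) [CommRing R] (s t : A → V) where
  M : V → Type
  [acg : ∀ i, AddCommGroup (M i)]
  [mod : ∀ i, Module R (M i)]
  f : ∀ a : A, M (s a) →ₗ[R] M (t a)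

attribute [instance] QRepR.acg QRepR.mod

variable {R : Type} [CommRing R] {s t : A → V}

/-- The `R`-linear map `Π_i Hom_R(X_i, Y_i) → Π_a Hom_R(X_{s(a)}, Y_{t(a)})`,
`g ↦ (f^Y_a ∘ g_{s(a)} − g_{t(a)} ∘ f^X_a)_a`, whose kernel is `Hom_{RQ}(X,Y)` and whose
cokernel is `Ext¹_{RQ}(X, Y)` (for `X` an `RQ`-lattice). -/
def deltaL (X Y : QRepR R s t) :
    (∀ i, X.M i →ₗ[R] Y.M i) →ₗ[R] (∀ a : A, X.M (s a) →ₗ[R] Y.M (t a)) :=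
  LinearMap.pi fun a =>
    ((LinearMap.llcomp R (X.M (s a)) (Y.M (s a)) (Y.M (t a)) (Y.f a)).comp
        (LinearMap.proj (s a)))
      - ((LinearMap.lcomp R (Y.M (t a)) (X.f a)).comp (LinearMap.proj (t a)))

/-- `Ext¹_{RQ}(X, Y)`, computed as the cokernel of `deltaL` (valid since `X` is an
`RQ`-lattice, which has projective dimension at most one). -/
def ext1 (X Y : QRepR R s t) : Type :=
  (∀ a : A, X.M (s a) →ₗ[R] Y.M (t a)) ⧸ LinearMap.range (deltaL X Y)

noncomputable instance (X Y : QRepR R s t) : AddCommGroup (ext1 X Y) :=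
  inferInstanceAs (AddCommGroup ((∀ a : A, X.M (s a) →ₗ[R] Y.M (t a)) ⧸
    LinearMap.range (deltaL X Y)))

noncomputable instance (X Y : QRepR R s t) : Module R (ext1 X Y) :=
  inferInstanceAs (Module R ((∀ a : A, X.M (s a) →ₗ[R] Y.M (t a)) ⧸
    LinearMap.range (deltaL X Y)))

/-- Base change of a representation: `T ⊗_R X`, an `TQ`-module. -/
noncomputable def baseChangeRep (T : Type) [CommRing T] [Algebra R T]
    (X : QRepR R s t) : QRepR T s t where
  M i := T ⊗[R] X.M i
  f a := LinearMap.baseChange T (X.f a)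

section Helpers

theorem baseChangeHom_isBaseChange_free (R T M N : Type) [CommRing R] [CommRing T] [Algebra R T]
    [AddCommGroup M] [Module R M] [AddCommGroup N] [Module R N]
    [Module.Free R M] [Module.Finite R M] :
    IsBaseChange T (LinearMap.baseChangeHom R T M N) := by
  have h := IsBaseChange.linearMapLeftRight (TensorProduct.isBaseChange R M T)
    (TensorProduct.isBaseChange R N T)
  convert h using 1
  ext f m
  have := IsBaseChange.linearMapLeftRightHom_comp_apply (TensorProduct.isBaseChange R M T)
    (TensorProduct.mk R T N 1) f m
  simp only [TensorProduct.mk_apply] at this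
  simp [LinearMap.baseChangeHom, this]

theorem baseChangeHom_isBaseChange (R T M N : Type) [CommRing R] [CommRing T] [Algebra R T]
    [AddCommGroup M] [Module R M] [AddCommGroup N] [Module R N]
    [Module.Finite R M] [Module.Projective R M] :
    IsBaseChange T (LinearMap.baseChangeHom R T M N) := by
  obtain ⟨n, p, i, -, -, hpi⟩ := Module.Finite.exists_comp_eq_id_of_projective R M
  have hF := baseChangeHom_isBaseChange_free R T (Fin n → R) N
  -- the comparison maps
  let bM : T ⊗[R] (M →ₗ[R] N) →ₗ[T] (T ⊗[R] M →ₗ[T] T ⊗[R] N) :=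
    (LinearMap.baseChangeHom R T M N).liftBaseChange T
  let bF : T ⊗[R] ((Fin n → R) →ₗ[R] N) →ₗ[T] (T ⊗[R] (Fin n → R) →ₗ[T] T ⊗[R] N) :=
    (LinearMap.baseChangeHom R T (Fin n → R) N).liftBaseChange T
  have ebF : ∀ x, bF x = hF.equiv x := by
    intro x
    induction x with
    | zero => simp
    | add x y hx hy => rw [map_add, map_add, hx, hy]
    | tmul c f => rw [hF.equiv_tmul]; rfl
  have bF_inj : Function.Injective bF := fun x y h => by
    rw [ebF, ebF] at h; exact hF.equiv.injective h
  have bF_surj : Function.Surjective bF := fun y => by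
    obtain ⟨x, hx⟩ := hF.equiv.surjective y
    exact ⟨x, (ebF x).trans hx⟩
  let P := (LinearMap.lcomp R N p).lTensor T
  let I := (LinearMap.lcomp R N i).lTensor T
  have hIP : ∀ x, I (P x) = x := by
    intro x
    have : LinearMap.lcomp R N i ∘ₗ LinearMap.lcomp R N p = LinearMap.id := by
      ext f m
      have := LinearMap.congr_fun hpi m
      simp at this
      simp [this]
    change ((LinearMap.lcomp R N i).lTensor T) ((LinearMap.lcomp R N p).lTensor T x) = x
    rw [← LinearMap.comp_apply, ← LinearMap.lTensor_comp, this, LinearMap.lTensor_id]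
    rfl
  have hP : ∀ x, bF (P x) = bM x ∘ₗ p.baseChange T := by
    intro x
    induction x with
    | zero => simp
    | add x y hx hy => rw [map_add, map_add, hx, hy, map_add, LinearMap.add_comp]
    | tmul c f =>
      refine TensorProduct.AlgebraTensorModule.curry_injective ?_
      ext m
      simp [bF, bM, P, LinearMap.baseChangeHom]
  have hI : ∀ y, bM (I y) = bF y ∘ₗ i.baseChange T := by
    intro x
    induction x with
    | zero => simp
    | add x y hx hy => rw [map_add, map_add, hx, hy, map_add, LinearMap.add_comp]
    | tmul c f =>
      refine TensorProduct.AlgebraTensorModule.curry_injective ?_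
      ext m
      simp [bF, bM, I, LinearMap.baseChangeHom]
  have hb : Function.Bijective bM := by
    constructor
    · rw [injective_iff_map_eq_zero]
      intro x hx
      have h0 : P x = 0 := by
        apply bF_inj
        rw [hP, hx, map_zero, LinearMap.zero_comp]
      rw [← hIP x, h0, map_zero]
    · intro φ
      obtain ⟨y, hy⟩ := bF_surj (φ ∘ₗ p.baseChange T)
      refine ⟨I y, ?_⟩
      rw [hI, hy, LinearMap.comp_assoc, ← LinearMap.baseChange_comp, hpi, LinearMap.baseChange_id,
        LinearMap.comp_id]
  refine IsBaseChange.of_equiv (LinearEquiv.ofBijective bM hb) ?_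
  intro f
  simp [bM]

theorem coker_baseChange (R T M₁ M₂ N₁ N₂ : Type) [CommRing R] [CommRing T] [Algebra R T]
    [AddCommGroup M₁] [AddCommGroup M₂] [AddCommGroup N₁] [AddCommGroup N₂]
    [Module R M₁] [Module R M₂] [Module R N₁] [Module R N₂] [Module T N₁] [Module T N₂]
    [IsScalarTower R T N₁] [IsScalarTower R T N₂]
    (h₁ : M₁ →ₗ[R] N₁) (h₂ : M₂ →ₗ[R] N₂) (f : M₁ →ₗ[R] M₂) (f' : N₁ →ₗ[T] N₂)
    (isb₁ : IsBaseChange T h₁) (isb₂ : IsBaseChange T h₂)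
    (comm : h₂.comp f = (f'.restrictScalars R).comp h₁) :
    ∃ g : (T ⊗[R] (M₂ ⧸ LinearMap.range f)) →ₗ[T] (N₂ ⧸ LinearMap.range f'),
      (∀ (c : T) (h : M₂), g (c ⊗ₜ[R] (Submodule.Quotient.mk h)) =
        Submodule.Quotient.mk (c • h₂ h)) ∧ Function.Bijective g := by
  let h₃ : (M₂ ⧸ LinearMap.range f) →ₗ[R] (N₂ ⧸ LinearMap.range f') :=
    (LinearMap.range f).liftQ (((LinearMap.range f').mkQ.restrictScalars R).comp h₂) (by
      rintro _ ⟨x, rfl⟩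
      have := LinearMap.congr_fun comm x
      simp only [LinearMap.comp_apply, LinearMap.restrictScalars_apply] at this
      simp [this])
  have isb₃ : IsBaseChange T h₃ := by
    refine IsBaseChange.of_right_exact T h₁ h₂ h₃ (g := (LinearMap.range f).mkQ)
      (g' := (LinearMap.range f').mkQ) comm ?_ isb₁ isb₂ ?_ (Submodule.mkQ_surjective _) ?_
      (Submodule.mkQ_surjective _)
    · ext x; simp [h₃]
    · exact LinearMap.exact_map_mkQ_range f
    · exact LinearMap.exact_map_mkQ_range f'
  refine ⟨isb₃.equiv.toLinearMap, ?_, isb₃.equiv.bijective⟩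
  intro c h
  rw [LinearEquiv.coe_coe, isb₃.equiv_tmul]
  rfl

theorem ext1_baseChange_aux (R T : Type) [CommRing R] [CommRing T] [Algebra R T]
    (V A : Type) [Finite V] [Finite A] (s t : A → V)
    (M N M' N' : V → Type) [∀ i, AddCommGroup (M i)] [∀ i, Module R (M i)]
    [∀ i, AddCommGroup (N i)] [∀ i, Module R (N i)]
    [∀ i, AddCommGroup (M' i)] [∀ i, Module T (M' i)]
    [∀ i, AddCommGroup (N' i)] [∀ i, Module R (N' i)] [∀ i, Module T (N' i)]
    [∀ i, IsScalarTower R T (N' i)]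
    (b : ∀ i j, (M i →ₗ[R] N j) →ₗ[R] (M' i →ₗ[T] N' j))
    (hb : ∀ i j, IsBaseChange T (b i j))
    (d : (∀ i, M i →ₗ[R] N i) →ₗ[R] (∀ a, M (s a) →ₗ[R] N (t a)))
    (d' : (∀ i, M' i →ₗ[T] N' i) →ₗ[T] (∀ a, M' (s a) →ₗ[T] N' (t a)))
    (hd : ∀ u a, b (s a) (t a) (d u a) = d' (fun i => b i i (u i)) a) :
    ∃ g : (T ⊗[R] ((∀ a, M (s a) →ₗ[R] N (t a)) ⧸ LinearMap.range d)) →ₗ[T]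
        ((∀ a, M' (s a) →ₗ[T] N' (t a)) ⧸ LinearMap.range d'),
      (∀ (c : T) (h : ∀ a, M (s a) →ₗ[R] N (t a)),
        g (c ⊗ₜ[R] (Submodule.Quotient.mk h)) =
          Submodule.Quotient.mk (c • fun a => b (s a) (t a) (h a))) ∧
      Function.Bijective g := by
  refine coker_baseChange R T _ _ _ _ _ _ d d'
    (IsBaseChange.pi (fun i => b i i) fun i => hb i i)
    (IsBaseChange.pi (fun a => b (s a) (t a)) fun a => hb (s a) (t a)) ?_
  refine LinearMap.ext fun u => funext fun a => ?_
  exact hd u a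

end Helpers

set_option maxHeartbeats 400000 in
/-- **Base change for `Ext¹` (Crawley-Boevey).** Let `Q` be a finite acyclic quiver,
`R → T` a homomorphism of commutative rings, `X` an `RQ`-lattice (so of projective
dimension at most one) and `Y` an `RQ`-module. Then there is a natural `T`-linear
surjection `T ⊗_R Ext¹_{RQ}(X, Y) → Ext¹_{TQ}(T ⊗_R X, T ⊗_R Y)`, determined by
sending `c ⊗ [h]` to `[c • (h ⊗ T)]`; moreover it is an isomorphism when `T` is
flat over `R`. -/
theorem ext1_baseChange_surjective (T : Type) [CommRing T] [Algebra R T]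
    (hQ : IsAcyclic s t) (X Y : QRepR R s t)
    (hlat : ∀ i, Module.Finite R (X.M i) ∧ Module.Projective R (X.M i)) :
    ∃ g : (T ⊗[R] ext1 X Y) →ₗ[T] ext1 (baseChangeRep T X) (baseChangeRep T Y),
      (∀ (c : T) (h : ∀ a : A, X.M (s a) →ₗ[R] Y.M (t a)),
        g (c ⊗ₜ[R] (Submodule.Quotient.mk h : ext1 X Y)) =
          (Submodule.Quotient.mk (c • fun a => LinearMap.baseChange T (h a)) :
            ext1 (baseChangeRep T X) (baseChangeRep T Y))) ∧
      Function.Surjective g ∧ (Module.Flat R T → Function.Bijective g) := by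
  letI iR : ∀ i, Module R ((baseChangeRep T Y).M i) := fun i =>
    inferInstanceAs (Module R (T ⊗[R] Y.M i))
  haveI iS : ∀ i, IsScalarTower R T ((baseChangeRep T Y).M i) := fun i =>
    inferInstanceAs (IsScalarTower R T (T ⊗[R] Y.M i))
  let b : ∀ i j, (X.M i →ₗ[R] Y.M j) →ₗ[R]
      ((baseChangeRep T X).M i →ₗ[T] (baseChangeRep T Y).M j) := fun i j =>
    LinearMap.baseChangeHom R T (X.M i) (Y.M j)
  have hb : ∀ i j, IsBaseChange T (b i j) := fun i j => by
    have := (hlat i).1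
    have := (hlat i).2
    exact baseChangeHom_isBaseChange R T (X.M i) (Y.M j)
  have hd : ∀ (u : ∀ i, X.M i →ₗ[R] Y.M i) (a : A), b (s a) (t a) (deltaL X Y u a) =
      deltaL (baseChangeRep T X) (baseChangeRep T Y) (fun i => b i i (u i)) a := by
    intro u a
    change (Y.f a ∘ₗ u (s a) - u (t a) ∘ₗ X.f a).baseChange T =
      (Y.f a).baseChange T ∘ₗ (u (s a)).baseChange T -
        (u (t a)).baseChange T ∘ₗ (X.f a).baseChange T
    rw [LinearMap.baseChange_sub, LinearMap.baseChange_comp, LinearMap.baseChange_comp]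
  obtain ⟨g, hg, hbij⟩ := ext1_baseChange_aux R T V A s t X.M Y.M _ _ b hb (deltaL X Y)
    (deltaL (baseChangeRep T X) (baseChangeRep T Y)) hd
  exact ⟨g, fun c h => hg c h, hbij.2, fun _ => hbij⟩
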